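/- For every positive integer n, Σ_{π ∈ B_n} (−1)^{inv_B(π)} s^{asc_B(π)} t^{des_B(π)} = (s−t)^n, as an identity of polynomials in s and t. -/

import Mathlib

open scoped BigOperators


/-- A model of the hyperoctahedral group `B_n`: a signed permutation is a permutation of
`{1,...,n}` together with a sign for each position; `π_i = ±σ(i)`. -/
abbrev BG (n : ℕ) := Equiv.Perm (Fin n) × (Fin n → Bool)

/-- The value `π_{i+1} ∈ {−n,...,−1,1,...,n}` of a signed permutation at (0-indexed) position `i`. -/
def bval {n : ℕ} (π : BG n) (i : Fin n) : ℤ :=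
  (if π.2 i then -1 else 1) * ((π.1 i : ℤ) + 1)

/-- The value `π_i` at 1-indexed position `i ∈ {1,...,n}`, with the convention `π_0 = 0`. -/
def bvalExt {n : ℕ} (π : BG n) (i : ℕ) : ℤ :=
  if h : 1 ≤ i ∧ i ≤ n then bval π ⟨i - 1, by omega⟩ else 0

/-- `des_B(π) = |{i ∈ {0,...,n−1} : π_i > π_{i+1}}|` with `π_0 = 0`. -/
def desB {n : ℕ} (π : BG n) : ℕ :=
  ((Finset.range n).filter (fun i => bvalExt π (i + 1) < bvalExt π i)).card

/-- `asc_B(π) = n − des_B(π)`. -/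
def ascB {n : ℕ} (π : BG n) : ℕ := n - desB π

/-- `negs(π) = |{i ∈ [n] : π_i < 0}|`. -/
def negs {n : ℕ} (π : BG n) : ℕ :=
  (Finset.univ.filter (fun i : Fin n => bval π i < 0)).card

/-- `inv_A(π) = |{1 ≤ i < j ≤ n : π_i > π_j}|` (usual order on `ℤ`). -/
def invAB {n : ℕ} (π : BG n) : ℕ :=
  (Finset.univ.filter (fun p : Fin n × Fin n => p.1 < p.2 ∧ bval π p.2 < bval π p.1)).card

/-- `inv_D(π) = inv_A(π) + |{1 ≤ i < j ≤ n : −π_i > π_j}|`. -/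
def invDB {n : ℕ} (π : BG n) : ℕ :=
  invAB π +
    (Finset.univ.filter (fun p : Fin n × Fin n => p.1 < p.2 ∧ bval π p.2 < -bval π p.1)).card

/-- `inv_B(π) = inv_A(π) + |{1 ≤ i < j ≤ n : −π_i > π_j}| + negs(π)`. -/
def invBB {n : ℕ} (π : BG n) : ℕ := invDB π + negs π

/-- `exc_B(π) = |{i ∈ [n] : π_{|π_i|} > π_i}| + |{i ∈ [n] : π_i = −i}|`. -/
def excB {n : ℕ} (π : BG n) : ℕ :=
  (Finset.univ.filter (fun i : Fin n => bval π i < bvalExt π (bval π i).natAbs)).card +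
    (Finset.univ.filter (fun i : Fin n => bval π i = -((i : ℤ) + 1))).card

lemma bval_neg_iff {n : ℕ} (π : BG n) (i : Fin n) : bval π i < 0 ↔ π.2 i = true := by
  unfold bval
  cases π.2 i <;> simp <;> omega

lemma negs_eq_card {n : ℕ} (π : BG n) :
    negs π = (Finset.univ.filter (fun i : Fin n => π.2 i = true)).card := by
  simp only [negs, bval_neg_iff]

lemma neg_one_pow_negs {n : ℕ} (π : BG n) :
    (-1 : ℤ) ^ negs π = ∏ i, if π.2 i = true then -1 else 1 := by
  rw [negs_eq_card, Finset.prod_ite]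
  simp

/-- The parity of `inv_D` only depends on the underlying permutation. -/
lemma neg_one_pow_invDB {n : ℕ} (π : BG n) :
    (-1 : ℤ) ^ invDB π =
      ∏ p : Fin n × Fin n, if p.1 < p.2 ∧ π.1 p.2 < π.1 p.1 then -1 else 1 := by
  have h (s : Fin n × Fin n → Prop) [DecidablePred s] :
      (-1 : ℤ) ^ (Finset.univ.filter s).card = ∏ p, if s p then -1 else 1 := by
    rw [Finset.prod_ite]
    simp
  rw [invDB, invAB, pow_add, h, h, ← Finset.prod_mul_distrib]
  refine Finset.prod_congr rfl fun p _ => ?_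
  by_cases hp : p.1 < p.2
  · have hne : (π.1 p.1 : ℕ) ≠ π.1 p.2 := fun he =>
      hp.ne (π.1.injective (Fin.ext he))
    simp only [hp, true_and, bval, Fin.lt_def]
    cases π.2 p.1 <;> cases π.2 p.2 <;> simp <;> split_ifs <;> first | rfl | omega
  · simp [hp]

/-- Changing the sign of the entry at position `j`. -/
def flipSign {n : ℕ} (j : Fin n) (ε : Fin n → Bool) : Fin n → Bool :=
  Function.update ε j (!ε j)

lemma flipSign_flipSign {n : ℕ} (j : Fin n) (ε : Fin n → Bool) :
    flipSign j (flipSign j ε) = ε := by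
  simp [flipSign]

lemma flipSign_ne {n : ℕ} (j : Fin n) (ε : Fin n → Bool) : flipSign j ε ≠ ε := fun h => by
  have := congrFun h j
  simp [flipSign] at this

lemma neg_one_pow_invBB_flipSign {n : ℕ} (σ : Equiv.Perm (Fin n)) (ε : Fin n → Bool)
    (j : Fin n) :
    (-1 : ℤ) ^ invBB (σ, flipSign j ε) = -(-1 : ℤ) ^ invBB (σ, ε) := by
  simp only [invBB, pow_add, neg_one_pow_invDB, neg_one_pow_negs]
  rw [← mul_neg]
  congr 1
  rw [← Finset.mul_prod_erase _ _ (Finset.mem_univ j),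
    ← Finset.mul_prod_erase Finset.univ (fun i => if ε i = true then (-1 : ℤ) else 1)
      (Finset.mem_univ j), ← neg_mul]
  congr 1
  · cases h : ε j <;> simp [flipSign, h]
  · refine Finset.prod_congr rfl fun i hi => ?_
    simp [flipSign, Function.update_of_ne (Finset.ne_of_mem_erase hi)]

lemma bvalExt_succ {n : ℕ} (π : BG n) (i : Fin n) : bvalExt π (i + 1) = bval π i := by
  have : 1 ≤ (i : ℕ) + 1 ∧ (i : ℕ) + 1 ≤ n := by omega
  simp [bvalExt, this]

lemma abs_bval {n : ℕ} (π : BG n) (i : Fin n) : |bval π i| = (π.1 i : ℤ) + 1 := by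
  rw [bval, abs_mul, abs_of_nonneg (a := (π.1 i : ℤ) + 1) (by omega)]
  split_ifs <;> simp

/-- A local minimum of the absolute values can change sign without changing the descents. -/
lemma desB_flipSign {n : ℕ} (σ : Equiv.Perm (Fin n)) (ε : Fin n → Bool) (j : Fin n)
    (hj : 0 < (j : ℕ))
    (hmin : ∀ i : Fin n, (i : ℕ) + 1 = j ∨ (i : ℕ) = j + 1 → σ j < σ i) :
    desB (σ, flipSign j ε) = desB (σ, ε) := by
  have hself : bval (σ, flipSign j ε) j = -bval (σ, ε) j := by
    cases h : ε j <;> simp [bval, flipSign, h]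
  have hother (i : Fin n) (h : i ≠ j) : bval (σ, flipSign j ε) i = bval (σ, ε) i := by
    simp [bval, flipSign, Function.update_of_ne h]
  have habs (i : Fin n) (h : σ j < σ i) : |bval (σ, ε) j| < |bval (σ, ε) i| := by
    rw [abs_bval, abs_bval]
    rw [Fin.lt_def] at h
    simpa using h
  unfold desB
  congr 1
  refine Finset.filter_congr fun i hi => ?_
  rw [Finset.mem_range] at hi
  rcases Nat.eq_zero_or_pos i with rfl | hpos
  · have h0 (ε' : Fin n → Bool) : bvalExt (σ, ε') 0 = 0 := by simp [bvalExt]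
    have hne : (⟨0, hi⟩ : Fin n) ≠ j := fun h => by simp [← h] at hj
    have h1 (ε' : Fin n → Bool) := bvalExt_succ (σ, ε') ⟨0, hi⟩
    simp only at h1
    rw [h0, h0, h1, h1, hother _ hne]
  · obtain ⟨m, rfl⟩ : ∃ m, i = m + 1 := ⟨i - 1, by omega⟩
    have h0 (ε' : Fin n → Bool) := bvalExt_succ (σ, ε') ⟨m, by omega⟩
    have h1 (ε' : Fin n → Bool) := bvalExt_succ (σ, ε') ⟨m + 1, hi⟩
    simp only at h0 h1
    rw [h0, h0, h1, h1]
    by_cases ha : (⟨m, by omega⟩ : Fin n) = j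
    · have hb : (⟨m + 1, hi⟩ : Fin n) ≠ j := fun h => by simp [← ha] at h
      have := habs ⟨m + 1, hi⟩ (hmin _ (Or.inr (by simp [← ha])))
      rw [hother _ hb, ha, hself]
      grind
    · by_cases hb : (⟨m + 1, hi⟩ : Fin n) = j
      · have := habs ⟨m, by omega⟩ (hmin _ (Or.inl (by simp [← hb])))
        rw [hother _ ha, hb, hself]
        grind
      · rw [hother _ ha, hother _ hb]

/-- A nontrivial permutation has a local minimum away from the first position. -/
lemma exists_local_min_of_ne_one {n : ℕ} {σ : Equiv.Perm (Fin n)} (hσ : σ ≠ 1) :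
    ∃ j : Fin n, 0 < (j : ℕ) ∧
      ∀ i : Fin n, (i : ℕ) + 1 = j ∨ (i : ℕ) = j + 1 → σ j < σ i := by
  have hne : ∃ k, σ k ≠ k := by
    by_contra! h
    exact hσ (Equiv.ext h)
  obtain ⟨k, hk, hmin⟩ := WellFounded.has_min (wellFounded_lt (α := Fin n)) {k | σ k ≠ k} hne
  have hfix (i : Fin n) (hi : i < k) : σ i = i := by
    by_contra h
    exact hmin i h hi
  have hlt : k < σ.symm k := by
    rcases lt_trichotomy k (σ.symm k) with h | h | h
    · exact h
    · exact absurd (by conv_lhs => rw [h, σ.apply_symm_apply]) hk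
    · have := hfix _ h
      rw [σ.apply_symm_apply] at this
      exact absurd this h.ne'
  refine ⟨σ.symm k, by rw [Fin.lt_def] at hlt; omega, fun i hi => ?_⟩
  rw [σ.apply_symm_apply]
  have hki : k ≤ i := by rw [Fin.lt_def] at hlt; rw [Fin.le_def]; omega
  by_contra! h
  rcases h.lt_or_eq with h | h
  · have := σ.injective (hfix _ h)
    rw [this] at h
    exact absurd hki (not_le.2 h)
  · rw [← h, σ.symm_apply_apply] at hi
    omega

lemma sum_signs_eq_zero {n : ℕ} {σ : Equiv.Perm (Fin n)} (hσ : σ ≠ 1) :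
    ∑ ε : Fin n → Bool,
      (MvPolynomial.C ((-1 : ℤ) ^ invBB (σ, ε)) *
        MvPolynomial.X (0 : Fin 2) ^ ascB (σ, ε) * MvPolynomial.X (1 : Fin 2) ^ desB (σ, ε)) =
      0 := by
  obtain ⟨j, hj, hmin⟩ := exists_local_min_of_ne_one hσ
  refine Finset.sum_involution (fun ε _ => flipSign j ε) (fun ε _ => ?_)
    (fun ε _ _ => flipSign_ne j ε) (fun _ _ => Finset.mem_univ _)
    (fun ε _ => flipSign_flipSign j ε)
  rw [neg_one_pow_invBB_flipSign, ascB, ascB, desB_flipSign σ ε j hj hmin, map_neg]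
  ring

lemma descent_one_iff {n : ℕ} (ε : Fin n → Bool) (i : Fin n) :
    bvalExt ((1, ε) : BG n) (i + 1) < bvalExt ((1, ε) : BG n) i ↔ ε i = true := by
  rw [bvalExt_succ]
  obtain ⟨i, hi⟩ := i
  cases i with
  | zero => cases h : ε ⟨0, hi⟩ <;> simp [bval, bvalExt, h]
  | succ m =>
    have hm := bvalExt_succ ((1, ε) : BG n) ⟨m, by omega⟩
    simp only at hm ⊢
    rw [hm]
    cases h : ε ⟨m + 1, hi⟩ <;> cases h' : ε ⟨m, by omega⟩ <;> simp [bval, h, h'] <;> omega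

lemma desB_one {n : ℕ} (ε : Fin n → Bool) :
    desB ((1, ε) : BG n) = (Finset.univ.filter (fun i : Fin n => ε i = true)).card := by
  refine (Finset.card_bij (fun (i : Fin n) _ => (i : ℕ)) (fun i hi => ?_)
    (fun _ _ _ _ h => by exact Fin.ext h) fun i hi => ?_).symm
  · rw [Finset.mem_filter, Finset.mem_range]
    exact ⟨i.2, (descent_one_iff ε i).2 (Finset.mem_filter.1 hi).2⟩
  · rw [Finset.mem_filter, Finset.mem_range] at hi
    exact ⟨⟨i, hi.1⟩, by simpa using (descent_one_iff ε ⟨i, hi.1⟩).1 hi.2, rfl⟩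

lemma neg_one_pow_invBB_one {n : ℕ} (ε : Fin n → Bool) :
    (-1 : ℤ) ^ invBB ((1, ε) : BG n) =
      (-1) ^ (Finset.univ.filter (fun i : Fin n => ε i = true)).card := by
  rw [invBB, pow_add, neg_one_pow_invDB, negs_eq_card, Finset.prod_eq_one, one_mul]
  intro p _
  exact if_neg fun h => absurd h.1 h.2.asymm

lemma sum_signs_one (n : ℕ) :
    ∑ ε : Fin n → Bool,
      (MvPolynomial.C ((-1 : ℤ) ^ invBB ((1, ε) : BG n)) *
        MvPolynomial.X (0 : Fin 2) ^ ascB ((1, ε) : BG n) *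
        MvPolynomial.X (1 : Fin 2) ^ desB ((1, ε) : BG n)) =
      (MvPolynomial.X (0 : Fin 2) - MvPolynomial.X (1 : Fin 2)) ^ n := by
  have h := Finset.prod_univ_sum (fun _ : Fin n => (Finset.univ : Finset Bool))
    (fun _ b => if b = true then -MvPolynomial.X (R := ℤ) (1 : Fin 2) else MvPolynomial.X 0)
  simp only [Fintype.sum_bool, if_true, Bool.false_eq_true, if_false, Finset.prod_const,
    Finset.card_univ, Fintype.card_fin, Fintype.piFinset_univ] at h
  rw [sub_eq_neg_add, h]
  refine Finset.sum_congr rfl fun ε _ => ?_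
  have hc := Finset.card_filter_add_card_filter_not
    (s := (Finset.univ : Finset (Fin n))) (fun i => ε i = true)
  rw [Finset.card_univ, Fintype.card_fin] at hc
  rw [neg_one_pow_invBB_one, ascB, desB_one, Finset.prod_ite, Finset.prod_const,
    Finset.prod_const, neg_pow (MvPolynomial.X (R := ℤ) (1 : Fin 2)), ← Nat.eq_sub_of_add_eq' hc]
  simp only [map_pow, map_neg, map_one]
  ring

/-- Reiner's theorem:
`Σ_{π ∈ B_n} (−1)^{inv_B(π)} s^{asc_B(π)} t^{des_B(π)} = (s−t)^n`. -/
theorem reiner_signed_bivariate (n : ℕ) (hn : 1 ≤ n) :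
    (∑ π : BG n,
        MvPolynomial.C ((-1 : ℤ) ^ invBB π) *
          MvPolynomial.X (0 : Fin 2) ^ ascB π * MvPolynomial.X (1 : Fin 2) ^ desB π) =
      (MvPolynomial.X (0 : Fin 2) - MvPolynomial.X (1 : Fin 2)) ^ n := by
  rw [Fintype.sum_prod_type, Finset.sum_eq_single 1 (fun σ _ hσ => sum_signs_eq_zero hσ)
    (fun h => absurd (Finset.mem_univ _) h), sum_signs_one]
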